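/- If the joint law of (W₁, W₂) under P equals the joint law of (W₁', W₂') under P', then there exists a ∈ ℝ such that the law of C' equals the law of C + a, the law of U₁' equals the law of U₁ + a, and the law of U₂' equals the law of U₂ + a; in particular, if additionally E[C] = E[C'], then the laws of C and C', of U₁ and U₁', and of U₂ and U₂' coincide. (The Kotlarski-type identification argument underlying Proposition 2, which identifies F_C, F_{U_s} and F_{U_t} in the general nonparametric-error case.) -/

import Mathlib

open MeasureTheory ProbabilityTheory

/-- A complex function on `ℝ` satisfying Cauchy's multiplicative equation, differentiable at `0`
and equal to `1` there, is an exponential. -/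
lemma eq_exp_of_map_add_eq_mul {r : ℝ → ℂ} {c : ℂ} (hr0 : r 0 = 1)
    (hadd : ∀ s t, r (s + t) = r s * r t) (hd : HasDerivAt r c 0) (t : ℝ) :
    r t = Complex.exp (t * c) := by
  have hd' (t : ℝ) : HasDerivAt r (r t * c) t := by
    have h : HasDerivAt (fun x : ℝ => r (x - t)) c t :=
      HasDerivAt.comp_sub_const t t (by simpa using hd)
    refine (h.const_mul (r t)).congr_of_eventuallyEq (.of_forall fun x => ?_)
    simp only [← hadd, add_sub_cancel]
  have hexp (t : ℝ) : HasDerivAt (fun x : ℝ => Complex.exp (-(x * c)))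
      (Complex.exp (-(t * c)) * -(1 * c)) t :=
    (((hasDerivAt_id t).ofReal_comp.mul_const c).neg).cexp
  have hq (t : ℝ) : HasDerivAt (fun x : ℝ => r x * Complex.exp (-(x * c))) 0 t := by
    refine ((hd' t).mul (hexp t)).congr_deriv ?_
    ring
  have hconst := is_const_of_deriv_eq_zero (fun x => (hq x).differentiableAt)
    (fun x => (hq x).deriv) t 0
  simp only [hr0, Complex.ofReal_zero, zero_mul, neg_zero, Complex.exp_zero, mul_one,
    Complex.exp_neg] at hconst
  field_simp at hconst
  exact hconst

lemma integral_id_map {Ω : Type*} [MeasurableSpace Ω] {P : Measure Ω} {X : Ω → ℝ}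
    (hX : Measurable X) : ∫ x, x ∂(P.map X) = ∫ ω, X ω ∂P :=
  integral_map hX.aemeasurable aestronglyMeasurable_id

lemma hasDerivAt_charFun_map_zero {Ω : Type*} [MeasurableSpace Ω] {P : Measure Ω}
    [IsProbabilityMeasure P] {X : Ω → ℝ} (hX : Measurable X) (hXi : Integrable X P) :
    HasDerivAt (charFun (P.map X)) (Complex.I * ((∫ ω, X ω ∂P : ℝ) : ℂ)) 0 := by
  have : IsProbabilityMeasure (P.map X) := Measure.isProbabilityMeasure_map hX.aemeasurable
  have hint : MemLp id ((1 : ℕ) : ENNReal) (P.map X) := by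
    rw [Nat.cast_one, memLp_one_iff_integrable,
      integrable_map_measure (by fun_prop) hX.aemeasurable]
    exact hXi
  have hd := ((contDiff_charFun hint).differentiable (by simp) 0).hasDerivAt
  rw [← iteratedDeriv_one, iteratedDeriv_charFun_zero hint] at hd
  simpa [integral_id_map hX] using hd

lemma charFun_map_fun_add_const {Ω : Type*} [MeasurableSpace Ω] {P : Measure Ω}
    {X : Ω → ℝ} (hX : Measurable X) (a t : ℝ) :
    charFun (P.map (fun ω => X ω + a)) t =
      charFun (P.map X) t * Complex.exp (a * t * Complex.I) := by
  have h : P.map (fun ω => X ω + a) = (P.map X).map (· + a) :=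
    (Measure.map_map (measurable_add_const a) hX).symm
  rw [h, charFun_map_add_const]
  simp [mul_comm]

/-- The joint characteristic function of `(U₁ - C, U₂ - C)`, for independent `C, U₁, U₂`. -/
lemma integral_exp_sub_sub {Ω : Type*} [MeasurableSpace Ω] {P : Measure Ω}
    [IsProbabilityMeasure P] {C U₁ U₂ : Ω → ℝ}
    (hC : Measurable C) (hU₁ : Measurable U₁) (hU₂ : Measurable U₂)
    (hind : IndepFun C (fun ω => (U₁ ω, U₂ ω)) P) (hindU : IndepFun U₁ U₂ P) (s t : ℝ) :
    ∫ p : ℝ × ℝ, Complex.exp (((s * p.1 + t * p.2 : ℝ) : ℂ) * Complex.I)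
        ∂(P.map (fun ω => (U₁ ω - C ω, U₂ ω - C ω))) =
      charFun (P.map U₁) s * charFun (P.map U₂) t * charFun (P.map C) (-(s + t)) := by
  have hU := hindU.integral_fun_comp_mul_comp (𝕜 := ℂ) hU₁.aemeasurable hU₂.aemeasurable
    (f := fun x : ℝ => Complex.exp (s * x * Complex.I))
    (g := fun x : ℝ => Complex.exp (t * x * Complex.I)) (by fun_prop) (by fun_prop)
  have hCU := hind.integral_fun_comp_mul_comp (𝕜 := ℂ) hC.aemeasurable
    (hU₁.prodMk hU₂).aemeasurable
    (f := fun x : ℝ => Complex.exp ((-(s + t) : ℝ) * x * Complex.I))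
    (g := fun p : ℝ × ℝ => Complex.exp (s * p.1 * Complex.I) * Complex.exp (t * p.2 * Complex.I))
    (by fun_prop) (by fun_prop)
  rw [integral_map (by fun_prop) (by fun_prop)]
  simp only [charFun_apply_real]
  rw [integral_map hU₁.aemeasurable (by fun_prop), integral_map hU₂.aemeasurable (by fun_prop),
    integral_map hC.aemeasurable (by fun_prop), ← hU, mul_comm, ← hCU]
  congr 1 with ω
  rw [← Complex.exp_add, ← Complex.exp_add]
  congr 1
  push_cast
  ring

lemma charFun_map_ne_zero {Ω : Type*} [MeasurableSpace Ω] {P : Measure Ω} {X : Ω → ℝ}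
    (hX : Measurable X)
    (h : ∀ t : ℝ, (∫ ω, Complex.exp ((t : ℂ) * (X ω : ℂ) * Complex.I) ∂P) ≠ 0) (t : ℝ) :
    charFun (P.map X) t ≠ 0 := by
  rw [charFun_apply_real, integral_map hX.aemeasurable (by fun_prop)]
  exact h t

lemma charFun_map_zero {Ω : Type*} [MeasurableSpace Ω] {P : Measure Ω} [IsProbabilityMeasure P]
    {X : Ω → ℝ} (hX : Measurable X) : charFun (P.map X) 0 = 1 := by
  have := Measure.isProbabilityMeasure_map (μ := P) hX.aemeasurable
  simp

/-- If the characteristic functions of `X` and `X'` differ by the factor `exp (i a t)`, then `X'`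
has the law of `X + a`. -/
lemma map_eq_map_add_const {Ω Ω' : Type*} [MeasurableSpace Ω] [MeasurableSpace Ω']
    {P : Measure Ω} {P' : Measure Ω'} [IsProbabilityMeasure P] [IsProbabilityMeasure P']
    {X : Ω → ℝ} {X' : Ω' → ℝ} (hX : Measurable X) (a : ℝ)
    (h : ∀ t : ℝ, charFun (P'.map X') t =
      charFun (P.map X) t * Complex.exp (a * t * Complex.I)) :
    P'.map X' = P.map (fun ω => X ω + a) := by
  apply Measure.ext_of_charFun
  ext t
  rw [h, charFun_map_fun_add_const hX]

/-- Kotlarski-type identification (Proposition 2): if `C, U₁, U₂` are mutually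
independent integrable real random variables with nowhere-vanishing characteristic
functions, `W₁ = U₁ − C`, `W₂ = U₂ − C`, and the joint law of `(W₁, W₂)` coincides
across two such structures, then there is `a ∈ ℝ` with `law C' = law (C + a)`,
`law U₁' = law (U₁ + a)`, `law U₂' = law (U₂ + a)`; in particular if `E[C] = E[C']`
then the corresponding laws coincide. -/
theorem stmt_12
    {Ω : Type*} [MeasurableSpace Ω] (P : Measure Ω) [IsProbabilityMeasure P]
    {Ω' : Type*} [MeasurableSpace Ω'] (P' : Measure Ω') [IsProbabilityMeasure P']
    (C U₁ U₂ : Ω → ℝ) (C' U₁' U₂' : Ω' → ℝ)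
    (hC : Measurable C) (hU₁ : Measurable U₁) (hU₂ : Measurable U₂)
    (hC' : Measurable C') (hU₁' : Measurable U₁') (hU₂' : Measurable U₂')
    (hCi : Integrable C P) (hU₁i : Integrable U₁ P) (hU₂i : Integrable U₂ P)
    (hCi' : Integrable C' P') (hU₁i' : Integrable U₁' P') (hU₂i' : Integrable U₂' P')
    -- mutual independence of `C`, `U₁`, `U₂`
    (hind : IndepFun C (fun ω => (U₁ ω, U₂ ω)) P) (hindU : IndepFun U₁ U₂ P)
    (hind' : IndepFun C' (fun ω => (U₁' ω, U₂' ω)) P') (hindU' : IndepFun U₁' U₂' P')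
    -- nowhere-vanishing characteristic functions
    (hφC : ∀ t : ℝ, (∫ ω, Complex.exp ((t : ℂ) * (C ω : ℂ) * Complex.I) ∂P) ≠ 0)
    (hφU₁ : ∀ t : ℝ, (∫ ω, Complex.exp ((t : ℂ) * (U₁ ω : ℂ) * Complex.I) ∂P) ≠ 0)
    (hφU₂ : ∀ t : ℝ, (∫ ω, Complex.exp ((t : ℂ) * (U₂ ω : ℂ) * Complex.I) ∂P) ≠ 0)
    (hφC' : ∀ t : ℝ, (∫ ω, Complex.exp ((t : ℂ) * (C' ω : ℂ) * Complex.I) ∂P') ≠ 0)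
    (hφU₁' : ∀ t : ℝ, (∫ ω, Complex.exp ((t : ℂ) * (U₁' ω : ℂ) * Complex.I) ∂P') ≠ 0)
    (hφU₂' : ∀ t : ℝ, (∫ ω, Complex.exp ((t : ℂ) * (U₂' ω : ℂ) * Complex.I) ∂P') ≠ 0)
    -- equal joint laws of `(W₁, W₂) = (U₁ − C, U₂ − C)`
    (hlaw : P.map (fun ω => (U₁ ω - C ω, U₂ ω - C ω)) =
      P'.map (fun ω => (U₁' ω - C' ω, U₂' ω - C' ω))) :
    (∃ a : ℝ,
      P'.map C' = P.map (fun ω => C ω + a) ∧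
      P'.map U₁' = P.map (fun ω => U₁ ω + a) ∧
      P'.map U₂' = P.map (fun ω => U₂ ω + a)) ∧
    ((∫ ω, C ω ∂P) = (∫ ω, C' ω ∂P') →
      P'.map C' = P.map C ∧ P'.map U₁' = P.map U₁ ∧ P'.map U₂' = P.map U₂) := by
  have hg := charFun_map_ne_zero hU₁ hφU₁
  have hh := charFun_map_ne_zero hU₂ hφU₂
  have hf' := charFun_map_ne_zero hC' hφC'
  have hg0 := charFun_map_zero (P := P) hU₁
  have hh0 := charFun_map_zero (P := P) hU₂
  have hg0' := charFun_map_zero (P := P') hU₁'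
  have hh0' := charFun_map_zero (P := P') hU₂'
  have key (s t : ℝ) := (integral_exp_sub_sub hC' hU₁' hU₂' hind' hindU' s t).symm.trans
    ((congrArg (fun μ => ∫ p : ℝ × ℝ,
      Complex.exp (((s * p.1 + t * p.2 : ℝ) : ℂ) * Complex.I) ∂μ) hlaw.symm).trans
      (integral_exp_sub_sub hC hU₁ hU₂ hind hindU s t))
  have hdg := hasDerivAt_charFun_map_zero hU₁ hU₁i
  have hdg' := hasDerivAt_charFun_map_zero hU₁' hU₁i'
  set f := charFun (P.map C)
  set g := charFun (P.map U₁)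
  set h := charFun (P.map U₂)
  set f' := charFun (P'.map C')
  set g' := charFun (P'.map U₁')
  set h' := charFun (P'.map U₂')
  set r : ℝ → ℂ := fun t => g' t / g t with hr
  have hg'r (t : ℝ) : g' t = g t * r t := (mul_div_cancel₀ _ (hg t)).symm
  have hrf (t : ℝ) : r t * f' (-t) = f (-t) := by
    have h1 := key t 0
    simp only [hh0, hh0', mul_one, add_zero, hg'r] at h1
    exact mul_left_cancel₀ (hg t) (by rw [← h1]; ring)
  have hh'r (t : ℝ) : h' t = h t * r t := by
    have h1 := key 0 t
    simp only [hg0, hg0', one_mul, zero_add, ← hrf] at h1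
    exact mul_right_cancel₀ (hf' (-t)) (by rw [h1]; ring)
  have hadd (s t : ℝ) : r (s + t) = r s * r t := by
    have h1 := key s t
    rw [← hrf, hg'r, hh'r] at h1
    refine (mul_left_cancel₀ (mul_ne_zero (mul_ne_zero (hg s) (hh t)) (hf' (-(s + t)))) ?_).symm
    linear_combination h1
  have hr0 : r 0 = 1 := by simp [hr, hg0, hg0']
  set a : ℝ := (∫ ω, U₁' ω ∂P') - ∫ ω, U₁ ω ∂P with ha
  have hdr : HasDerivAt r (a * Complex.I) 0 := by
    refine (hdg'.div hdg (hg 0)).congr_deriv ?_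
    rw [hg0, hg0', ha]
    push_cast
    ring
  have hexp (t : ℝ) : r t = Complex.exp (a * t * Complex.I) := by
    rw [eq_exp_of_map_add_eq_mul hr0 hadd hdr]
    congr 1
    ring
  have hf'r (t : ℝ) : f' t = f t * r t := by
    have h1 := hrf (-t)
    have h2 := hadd t (-t)
    rw [neg_neg] at h1
    rw [add_neg_cancel, hr0] at h2
    linear_combination f' t * h2 + r t * h1
  have lawC := map_eq_map_add_const (P := P) (P' := P') (X' := C') hC a
    fun t => by rw [← hexp]; exact hf'r t
  have lawU₁ := map_eq_map_add_const (P := P) (P' := P') (X' := U₁') hU₁ a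
    fun t => by rw [← hexp]; exact hg'r t
  have lawU₂ := map_eq_map_add_const (P := P) (P' := P') (X' := U₂') hU₂ a
    fun t => by rw [← hexp]; exact hh'r t
  refine ⟨⟨a, lawC, lawU₁, lawU₂⟩, fun hE => ?_⟩
  have hmean := congrArg (fun μ : Measure ℝ => ∫ x, x ∂μ) lawC
  rw [integral_id_map hC', integral_id_map (hC.add_const a),
    integral_add hCi (integrable_const a), ← hE] at hmean
  have ha0 : a = 0 := by simpa using hmean
  simp only [ha0, add_zero] at lawC lawU₁ lawU₂
  exact ⟨lawC, lawU₁, lawU₂⟩
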